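/- arXiv:2302.03095 — 7 statements merged into one kernel-verified Lean document; each statement's English description precedes it below -/
import Mathlib

section
/- Every minimal lattice polygon has at most four vertices. That is: if 𝒜 ⊆ ℝ² is the convex hull of a finite subset of ℤ², the origin (0,0) lies in the interior of 𝒜, and for every vertex v of 𝒜 the origin does not lie in the interior of the collapse 𝒜⁻_v := conv((𝒜 ∩ ℤ²) \ {v}), then 𝒜 has at most four vertices (extreme points). -/
noncomputable section

open Set

/-- The plane `ℝ²` with its Euclidean structure. -/
abbrev Plane : Type := EuclideanSpace ℝ (Fin 2)

/-- A point of the plane is a lattice point if both coordinates are integers. -/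
def IsLatticePoint (p : Plane) : Prop := ∀ i : Fin 2, ∃ m : ℤ, p i = (m : ℝ)

/-- A lattice polygon: the convex hull of a finite subset of `ℤ²`. -/
def IsLatticePolygon (A : Set Plane) : Prop :=
  ∃ S : Finset Plane, (∀ p ∈ S, IsLatticePoint p) ∧ A = convexHull ℝ (S : Set Plane)

/-- The collapse `𝒜⁻_v` of `A` at `v`: the convex hull of `(A ∩ ℤ²) \ {v}`. -/
def collapse (A : Set Plane) (v : Plane) : Set Plane :=
  convexHull ℝ ((A ∩ {p | IsLatticePoint p}) \ {v})

/-- Every nonzero linear form on the plane is positive somewhere on `T`. -/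
def PositivelySpans (T : Set Plane) : Prop :=
  ∀ a b : ℝ, (a, b) ≠ 0 → ∃ t ∈ T, 0 < a * t 0 + b * t 1

/-- The determinant of two vectors of the plane. -/
def planeDet (p q : Plane) : ℝ := p 0 * q 1 - p 1 * q 0

theorem linearMap_apply_plane (f : Plane →ₗ[ℝ] ℝ) (p : Plane) :
    f p = f (EuclideanSpace.single 0 1) * p 0 + f (EuclideanSpace.single 1 1) * p 1 := by
  have hp : p = p 0 • EuclideanSpace.single (0 : Fin 2) (1 : ℝ)
      + p 1 • EuclideanSpace.single (1 : Fin 2) (1 : ℝ) := by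
    ext i
    fin_cases i <;> simp
  conv_lhs => rw [hp]
  simp only [map_add, map_smul, smul_eq_mul]
  ring

theorem PositivelySpans.exists_pos {T : Set Plane} (hT : PositivelySpans T)
    {f : Plane →ₗ[ℝ] ℝ} (hf : f ≠ 0) : ∃ t ∈ T, 0 < f t := by
  obtain ⟨t, ht, h⟩ := hT (f (EuclideanSpace.single 0 1)) (f (EuclideanSpace.single 1 1)) (by
    intro h
    rw [Prod.mk_eq_zero] at h
    apply hf
    ext p
    rw [linearMap_apply_plane, h.1, h.2]
    simp)
  exact ⟨t, ht, by rwa [linearMap_apply_plane]⟩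

theorem PositivelySpans.affineSpan_eq_top {T : Set Plane} (hT : PositivelySpans T) :
    affineSpan ℝ T = ⊤ := by
  obtain ⟨t₀, ht₀, -⟩ := hT 1 0 (by simp)
  rw [AffineSubspace.affineSpan_eq_top_iff_vectorSpan_eq_top_of_nonempty ℝ Plane Plane ⟨t₀, ht₀⟩]
  by_contra h
  obtain ⟨f, hf, hle⟩ := Submodule.exists_le_ker_of_lt_top _ (lt_top_iff_ne_top.2 h)
  have hconst : ∀ t ∈ T, f t = f t₀ := fun t ht => by
    have := hle (vsub_mem_vectorSpan ℝ ht ht₀)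
    rw [LinearMap.mem_ker, vsub_eq_sub, map_sub] at this
    linarith
  obtain ⟨t, ht, h1⟩ := hT.exists_pos hf
  obtain ⟨s, hs, h2⟩ := hT.exists_pos (neg_ne_zero.2 hf)
  rw [LinearMap.neg_apply, hconst s hs] at h2
  rw [hconst t ht] at h1
  linarith

theorem PositivelySpans.zero_mem_interior {T : Set Plane} (hT : PositivelySpans T) :
    (0 : Plane) ∈ interior (convexHull ℝ T) := by
  by_contra h0
  have hconv := convex_convexHull ℝ T
  have hne : (interior (convexHull ℝ T)).Nonempty :=
    interior_convexHull_nonempty_iff_affineSpan_eq_top.2 hT.affineSpan_eq_top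
  obtain ⟨f, hf⟩ := geometric_hahn_banach_open_point hconv.interior isOpen_interior h0
  obtain ⟨c, hc⟩ := hne
  have hf0 : (f : Plane →ₗ[ℝ] ℝ) ≠ 0 := by
    intro h
    have h2 : ∀ p, f p = 0 := fun p => LinearMap.congr_fun h p
    have := hf c hc
    rw [h2, h2] at this
    exact lt_irrefl _ this
  obtain ⟨t, ht, hpos⟩ := hT.exists_pos hf0
  have hmem : t ∈ closure (interior (convexHull ℝ T)) := by
    rw [hconv.closure_interior_eq_closure_of_nonempty_interior ⟨c, hc⟩]
    exact subset_closure (subset_convexHull ℝ T ht)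
  have hle : f t ≤ 0 :=
    closure_minimal (fun p hp => by simpa using (hf p hp).le)
      (isClosed_le f.continuous continuous_const) hmem
  exact absurd hpos (not_lt.2 hle)

theorem positivelySpans_of_zero_mem_interior {T : Set Plane}
    (h : (0 : Plane) ∈ interior (convexHull ℝ T)) : PositivelySpans T := by
  intro a b hab
  by_contra! hle
  have hconv : Convex ℝ {p : Plane | a * p 0 + b * p 1 ≤ 0} := by
    intro p hp q hq s t hs ht _
    simp only [mem_ofPred_eq, PiLp.add_apply, PiLp.smul_apply, smul_eq_mul] at *
    nlinarith [mul_nonpos_of_nonneg_of_nonpos hs hp, mul_nonpos_of_nonneg_of_nonpos ht hq]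
  have hsub : convexHull ℝ T ⊆ {p : Plane | a * p 0 + b * p 1 ≤ 0} := convexHull_min hle hconv
  have hcont : ContinuousAt (fun r : ℝ => r • (!₂[a, b] : Plane)) 0 := by fun_prop
  have hev : ∀ᶠ r in nhds (0 : ℝ), r • (!₂[a, b] : Plane) ∈ convexHull ℝ T :=
    hcont.eventually (by simpa using mem_interior_iff_mem_nhds.1 h)
  obtain ⟨r, hr, hr0⟩ :=
    ((hev.filter_mono nhdsWithin_le_nhds).and (self_mem_nhdsWithin (s := Ioi (0 : ℝ)))).exists
  have h1 := hsub hr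
  simp only [mem_ofPred_eq, PiLp.smul_apply, smul_eq_mul, Matrix.cons_val_zero,
    Matrix.cons_val_one] at h1
  have hr0 : 0 < r := hr0
  have hsq : 0 < a * a + b * b := by
    by_contra! hn
    apply hab
    rw [Prod.mk_eq_zero]
    constructor <;> nlinarith [mul_self_nonneg a, mul_self_nonneg b]
  nlinarith [mul_pos hr0 hsq]

theorem eq_zero_of_planeDet_ne_zero {a b : ℝ} {p q : Plane} (h : planeDet p q ≠ 0)
    (hp : a * p 0 + b * p 1 = 0) (hq : a * q 0 + b * q 1 = 0) : (a, b) = 0 := by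
  unfold planeDet at h
  rw [Prod.mk_eq_zero]
  constructor <;> apply (mul_eq_zero.1 _).resolve_right h
  · linear_combination q 1 * hp - p 1 * hq
  · linear_combination p 0 * hq - q 0 * hp

theorem positivelySpans_triple {x p q : Plane} (h1 : 0 < planeDet x p) (h2 : 0 < planeDet p q)
    (h3 : 0 < planeDet q x) : PositivelySpans {x, p, q} := by
  intro a b hab
  by_contra! hle
  simp only [mem_insert_iff, mem_singleton_iff, forall_eq_or_imp, forall_eq] at hle
  obtain ⟨hx, hp, hq⟩ := hle
  have key : planeDet p q * (a * x 0 + b * x 1) + planeDet q x * (a * p 0 + b * p 1)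
      + planeDet x p * (a * q 0 + b * q 1) = 0 := by
    unfold planeDet
    ring
  have e1 := mul_nonpos_of_nonneg_of_nonpos h2.le hx
  have e2 := mul_nonpos_of_nonneg_of_nonpos h3.le hp
  have e3 := mul_nonpos_of_nonneg_of_nonpos h1.le hq
  exact hab (eq_zero_of_planeDet_ne_zero h1.ne'
    ((mul_eq_zero.1 (by linarith : planeDet p q * (a * x 0 + b * x 1) = 0)).resolve_left h2.ne')
    ((mul_eq_zero.1 (by linarith : planeDet q x * (a * p 0 + b * p 1) = 0)).resolve_left h3.ne'))

theorem positivelySpans_quadruple {x t p q : Plane} {c : ℝ} (hc : c < 0) (ht : t = c • x)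
    (hp : 0 < planeDet x p) (hq : planeDet x q < 0) : PositivelySpans {x, t, p, q} := by
  intro a b hab
  by_contra! hle
  simp only [mem_insert_iff, mem_singleton_iff, forall_eq_or_imp, forall_eq] at hle
  obtain ⟨hx, ht', hp', hq'⟩ := hle
  simp only [ht, PiLp.smul_apply, smul_eq_mul] at ht'
  have hx0 : a * x 0 + b * x 1 = 0 := by
    refine le_antisymm hx ?_
    by_contra! hn
    nlinarith [mul_pos_of_neg_of_neg hc hn]
  have key : planeDet x p * (a * q 0 + b * q 1) - planeDet x q * (a * p 0 + b * p 1) = 0 := by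
    have h : planeDet x p * (a * q 0 + b * q 1) - planeDet x q * (a * p 0 + b * p 1)
        = -planeDet p q * (a * x 0 + b * x 1) := by
      unfold planeDet
      ring
    rw [h, hx0, mul_zero]
  have e1 := mul_nonpos_of_nonneg_of_nonpos hp.le hq'
  have e2 := mul_nonneg_of_nonpos_of_nonpos hq.le hp'
  exact hab (eq_zero_of_planeDet_ne_zero hp.ne' hx0
    ((mul_eq_zero.1 (by linarith : planeDet x q * (a * p 0 + b * p 1) = 0)).resolve_left hq.ne))

theorem norm_sq_mul_planeDet (x p q : Plane) :
    (x 0 ^ 2 + x 1 ^ 2) * planeDet p q = (x 0 * p 0 + x 1 * p 1) * planeDet x q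
      - planeDet x p * (x 0 * q 0 + x 1 * q 1) := by
  unfold planeDet
  ring

/-- **Steinitz's theorem** in the plane, for finite positively spanning sets. -/
theorem PositivelySpans.exists_subset_encard_le_four {V : Set Plane} (hV : V.Finite)
    (h : PositivelySpans V) : ∃ T ⊆ V, T.encard ≤ 4 ∧ PositivelySpans T := by
  obtain ⟨x, hxV, hx1⟩ := h 1 0 (by simp)
  have hx0 : 0 < x 0 := by linarith
  have hxx : 0 < x 0 ^ 2 + x 1 ^ 2 := by positivity
  obtain ⟨p₀, hp₀V, hp₀⟩ := h (-x 1) (x 0) (by simp [hx0.ne'])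
  have hp₀ : 0 < planeDet x p₀ := by
    unfold planeDet
    linarith
  by_cases hopp : ∃ t ∈ V, ∃ c : ℝ, c < 0 ∧ t = c • x
  · obtain ⟨t, htV, c, hc, ht⟩ := hopp
    obtain ⟨q, hqV, hq⟩ := h (x 1) (-x 0) (by simp [hx0.ne'])
    have hq : planeDet x q < 0 := by
      unfold planeDet
      linarith
    refine ⟨{x, t, p₀, q}, ?_, ?_, positivelySpans_quadruple hc ht hp₀ hq⟩
    · simp [insert_subset_iff, hxV, htV, hp₀V, hqV]
    · have h1 := encard_insert_le {t, p₀, q} x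
      have h2 := encard_insert_le {p₀, q} t
      have h3 := encard_insert_le {q} p₀
      rw [encard_singleton] at h3
      calc _ ≤ (1 + 1 + 1 + 1 : ℕ∞) := h1.trans (by gcongr; exact h2.trans (by gcongr))
        _ = 4 := by norm_num
  · obtain ⟨p, ⟨hpV, hp⟩, hpmin⟩ := exists_min_image {p ∈ V | 0 < planeDet x p}
      (fun p => (x 0 * p 0 + x 1 * p 1) / planeDet x p) (hV.subset (sep_subset _ _))
      ⟨p₀, hp₀V, hp₀⟩
    have hp : 0 < planeDet x p := hp
    obtain ⟨q, hqV, hq⟩ := h (-p 1) (p 0) (by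
      intro h0
      rw [Prod.mk_eq_zero] at h0
      unfold planeDet at hp
      rw [h0.2, neg_eq_zero.1 h0.1] at hp
      simp at hp)
    have hq : 0 < planeDet p q := by
      unfold planeDet
      linarith
    have hid := norm_sq_mul_planeDet x p q
    have hpos := mul_pos hxx hq
    have hqx : planeDet x q < 0 := by
      by_contra! hge
      rcases hge.lt_or_eq with hgt | heq
      · have hle := hpmin q ⟨hqV, hgt⟩
        rw [div_le_div_iff₀ hp hgt] at hle
        linarith
      · rw [← heq, mul_zero, zero_sub] at hid
        have hneg : x 0 * q 0 + x 1 * q 1 < 0 := by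
          by_contra! hn
          have := mul_nonneg hp.le hn
          linarith
        refine hopp ⟨q, hqV, (x 0 * q 0 + x 1 * q 1) / (x 0 ^ 2 + x 1 ^ 2),
          div_neg_of_neg_of_pos hneg hxx, ?_⟩
        unfold planeDet at heq
        ext i
        fin_cases i <;> simp <;> field_simp
        · linear_combination x 1 * heq
        · linear_combination -x 0 * heq
    refine ⟨{x, p, q}, ?_, ?_, positivelySpans_triple hp hq ?_⟩
    · simp [insert_subset_iff, hxV, hpV, hqV]
    · have h1 := encard_insert_le {p, q} x
      have h2 := encard_insert_le {q} p
      rw [encard_singleton] at h2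
      calc _ ≤ (1 + 1 + 1 : ℕ∞) := h1.trans (by gcongr)
        _ ≤ 4 := by norm_num
    · unfold planeDet at hqx ⊢
      linarith

theorem convexHull_extremePoints_convexHull {S : Set Plane} (hS : S.Finite) :
    convexHull ℝ ((convexHull ℝ S).extremePoints ℝ) = convexHull ℝ S := by
  have hfin : ((convexHull ℝ S).extremePoints ℝ).Finite :=
    hS.subset extremePoints_convexHull_subset
  rw [← (hfin.isClosed_convexHull ℝ).closure_eq]
  exact closure_convexHull_extremePoints (hS.isCompact_convexHull ℝ) (convex_convexHull ℝ S)

/-- Every minimal lattice polygon (with the origin as an interior point)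
has at most four vertices (extreme points). -/
theorem stmt_0 (A : Set Plane) (hA : IsLatticePolygon A)
    (h0 : (0 : Plane) ∈ interior A)
    (hmin : ∀ v ∈ A.extremePoints ℝ, (0 : Plane) ∉ interior (collapse A v)) :
    (A.extremePoints ℝ).encard ≤ 4 := by
  obtain ⟨S, hS, rfl⟩ := hA
  have hext : (convexHull ℝ (S : Set Plane)).extremePoints ℝ ⊆ S := extremePoints_convexHull_subset
  obtain ⟨T, hTV, hT4, hT⟩ := PositivelySpans.exists_subset_encard_le_four
    (S.finite_toSet.subset hext) (positivelySpans_of_zero_mem_interior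
      (by rwa [convexHull_extremePoints_convexHull S.finite_toSet]))
  by_contra hcard
  obtain ⟨v, hv, hvT⟩ : ∃ v ∈ (convexHull ℝ (S : Set Plane)).extremePoints ℝ, v ∉ T := by
    by_contra! hsub
    exact hcard ((encard_le_encard hsub).trans hT4)
  refine hmin v hv (interior_mono (convexHull_mono fun t ht => ?_) hT.zero_mem_interior)
  exact ⟨⟨extremePoints_subset (hTV ht), hS t (hext (hTV ht))⟩, fun h => hvT (h ▸ ht)⟩
end
end

section
/- Let k ≥ 1 be an integer and let 𝒜 ⊆ ℝ² be a polygon that is almost k-hollow. Let r > 0 be a real number such that the closed disk D_r of radius r centered at the origin is contained in 𝒜, and let v ∈ ℝ². If the expansion 𝒜⁺_v := conv(𝒜 ∪ {v}) is almost k-hollow, then the Euclidean norm of v satisfies ‖v‖ ≤ 2k²/r. -/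
noncomputable section

open Set

/-- A point of `k·ℤ²`. -/
def IsKLatticePoint (k : ℕ) (p : Plane) : Prop :=
  ∀ i : Fin 2, ∃ m : ℤ, p i = (k : ℝ) * (m : ℝ)

/-- Almost `k`-hollow: the interior of `A` meets `k·ℤ²` exactly in the origin. -/
def AlmostKHollow (k : ℕ) (A : Set Plane) : Prop :=
  interior A ∩ {p | IsKLatticePoint k p} = {0}

/-- Minkowski's theorem on linear forms, for the lattice `ℤ^ι`: a nonsingular matrix of
determinant less than `1` in absolute value sends some nonzero integer vector into the open
unit cube. -/
theorem exists_int_ne_zero_abs_mulVec_lt_one {ι : Type*} [Fintype ι] [DecidableEq ι]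
    (M : Matrix ι ι ℝ) (h0 : M.det ≠ 0) (h1 : |M.det| < 1) :
    ∃ n : ι → ℤ, n ≠ 0 ∧ ∀ i, |M.mulVec (fun j => (n j : ℝ)) i| < 1 := by
  set T := Matrix.toLin' M
  have hdet : LinearMap.det T = M.det := LinearMap.det_toLin' M
  have hvol : MeasureTheory.volume (Set.univ.pi fun _ : ι => Ioo (-1 : ℝ) 1)
      = 2 ^ Fintype.card ι := by
    rw [Real.volume_pi_Ioo]
    norm_num
  have hconv : Convex ℝ (T ⁻¹' Set.univ.pi fun _ : ι => Ioo (-1 : ℝ) 1) :=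
    (convex_pi fun _ _ => convex_Ioo _ _).linear_preimage T
  have hsymm : ∀ x ∈ T ⁻¹' Set.univ.pi (fun _ : ι => Ioo (-1 : ℝ) 1),
      -x ∈ T ⁻¹' Set.univ.pi fun _ : ι => Ioo (-1 : ℝ) 1 := by
    intro x hx i hi
    have := hx i hi
    simp only [map_neg, Pi.neg_apply, mem_Ioo] at this ⊢
    constructor <;> linarith [this.1, this.2]
  have fund := ZSpan.isAddFundamentalDomain' (Pi.basisFun ℝ ι) MeasureTheory.volume
  have hcard : MeasureTheory.volume (ZSpan.fundamentalDomain (Pi.basisFun ℝ ι))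
      * 2 ^ Module.finrank ℝ (ι → ℝ)
      < MeasureTheory.volume (T ⁻¹' Set.univ.pi fun _ : ι => Ioo (-1 : ℝ) 1) := by
    rw [MeasureTheory.Measure.addHaar_preimage_linearMap _ (by rwa [hdet]), hvol, hdet,
      ZSpan.fundamentalDomain_pi_basisFun, Real.volume_pi_Ico, Module.finrank_pi]
    have : 1 < ENNReal.ofReal |M.det⁻¹| := by
      rw [ENNReal.one_lt_ofReal, abs_inv]
      exact (one_lt_inv₀ (abs_pos.2 h0)).2 h1
    simpa using ENNReal.mul_lt_mul_left (by simp) (by finiteness) this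
  have : Countable (Submodule.span ℤ (Set.range (Pi.basisFun ℝ ι))).toAddSubgroup :=
    inferInstanceAs (Countable (Submodule.span ℤ (Set.range (Pi.basisFun ℝ ι))))
  obtain ⟨x, hx0, hx⟩ :=
    MeasureTheory.exists_ne_zero_mem_lattice_of_measure_mul_two_pow_lt_measure
      fund hsymm hconv hcard
  have hmem := ((Pi.basisFun ℝ ι).mem_span_iff_repr_mem ℤ (x : ι → ℝ)).1 x.2
  choose n hn using hmem
  have hxn : (fun j => (n j : ℝ)) = (x : ι → ℝ) := by
    ext j
    simpa using hn j
  refine ⟨n, ?_, fun i => ?_⟩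
  · rintro rfl
    apply hx0
    ext j
    simp [← hxn]
  · rw [hxn, abs_lt]
    exact hx i (Set.mem_univ i)

/-- If the ball of radius `r` lies in a convex set `C` containing `v`, so does, in its interior,
every `t • v + q` with `0 ≤ t` and `‖q‖ < r * (1 - t)`. -/
theorem Convex.smul_add_mem_interior {E : Type*} [NormedAddCommGroup E] [NormedSpace ℝ E]
    {C : Set E} (hC : Convex ℝ C) {r : ℝ} (hr : 0 < r) (hball : Metric.ball 0 r ⊆ C)
    {v : E} (hv : v ∈ C) {t : ℝ} (ht : 0 ≤ t) {q : E} (hq : ‖q‖ < r * (1 - t)) :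
    t • v + q ∈ interior C := by
  have ht1 : 0 < 1 - t := pos_of_mul_pos_right ((norm_nonneg q).trans_lt hq) hr.le
  have hmem : (1 - t)⁻¹ • q ∈ interior C := by
    refine interior_maximal hball Metric.isOpen_ball ?_
    rw [mem_ball_zero_iff, norm_smul, norm_inv, Real.norm_of_nonneg ht1.le,
      inv_mul_lt_iff₀ ht1]
    linarith
  have := hC.combo_self_interior_mem_interior hv hmem ht ht1 (by ring)
  rwa [smul_inv_smul₀ ht1.ne'] at this

/-- Let `A` be an almost `k`-hollow polygon containing the closed disk of
radius `r > 0` centered at the origin.  If the expansion `conv(A ∪ {v})` is almost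
`k`-hollow, then `‖v‖ ≤ 2k²/r`. -/
theorem stmt_2 (k : ℕ) (hk : 1 ≤ k) (A : Set Plane) (S : Finset Plane)
    (hA : A = convexHull ℝ (S : Set Plane))
    (hhollow : AlmostKHollow k A)
    (r : ℝ) (hr : 0 < r) (hD : Metric.closedBall (0 : Plane) r ⊆ A)
    (v : Plane)
    (hexp : AlmostKHollow k (convexHull ℝ (A ∪ {v}))) :
    ‖v‖ ≤ 2 * (k : ℝ) ^ 2 / r := by
  by_contra! hlt
  have hk0 : (0 : ℝ) < k := by exact_mod_cast hk
  have hN : 0 < ‖v‖ := lt_of_le_of_lt (by positivity) hlt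
  have hNr : 2 * (k : ℝ) ^ 2 < ‖v‖ * r := (div_lt_iff₀ hr).1 hlt
  have hN2 : ‖v‖ ^ 2 = v 0 ^ 2 + v 1 ^ 2 := by
    rw [EuclideanSpace.real_norm_sq_eq, Fin.sum_univ_two]
  set N := ‖v‖
  -- the coordinates of `k • n` along `v` and along `v` rotated by a right angle
  set a : Plane → ℝ := fun x => (x 0 * v 0 + x 1 * v 1) / N ^ 2 with ha
  set b : Plane → ℝ := fun x => (x 1 * v 0 - x 0 * v 1) / (N * r) with hb
  set M : Matrix (Fin 2) (Fin 2) ℝ :=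
    !![k * (v 0 / N ^ 2 - v 1 / (N * r)), k * (v 1 / N ^ 2 + v 0 / (N * r));
       k * (v 0 / N ^ 2 + v 1 / (N * r)), k * (v 1 / N ^ 2 - v 0 / (N * r))] with hM
  have hdet : M.det = -(2 * (k : ℝ) ^ 2 / (N * r)) := by
    have : M.det = -(2 * (k : ℝ) ^ 2 * (v 0 ^ 2 + v 1 ^ 2) / (N ^ 2 * (N * r))) := by
      rw [hM, Matrix.det_fin_two_of]
      field_simp
      ring
    rw [this, ← hN2]
    field_simp
  have hpos : 0 < 2 * (k : ℝ) ^ 2 / (N * r) := by positivity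
  obtain ⟨n, hn0, hn⟩ := exists_int_ne_zero_abs_mulVec_lt_one M
    (by rw [hdet]; exact neg_ne_zero.2 hpos.ne')
    (by rw [hdet, abs_neg, abs_of_pos hpos, div_lt_one (by positivity)]; exact hNr)
  have key : ∀ m : Fin 2 → ℤ, m ≠ 0 → (∀ i, |M.mulVec (fun j => (m j : ℝ)) i| < 1) →
      ¬ 0 ≤ (m 0 : ℝ) * v 0 + m 1 * v 1 := by
    intro m hm0 hm hnonneg
    set p : Plane := !₂[(k : ℝ) * m 0, (k : ℝ) * m 1] with hp
    have hta : 0 ≤ a p := by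
      simp only [ha, hp]
      refine div_nonneg ?_ (by positivity)
      have := mul_nonneg hk0.le hnonneg
      simp
      linarith
    have habs : |b p| < 1 - a p := by
      have e0 : M.mulVec (fun j => (m j : ℝ)) 0 = a p + b p := by
        simp [hM, ha, hb, hp, Matrix.mulVec, dotProduct, Fin.sum_univ_two]
        ring
      have e1 : M.mulVec (fun j => (m j : ℝ)) 1 = a p - b p := by
        simp [hM, ha, hb, hp, Matrix.mulVec, dotProduct, Fin.sum_univ_two]
        ring
      have h0 := hm 0
      have h1 := hm 1
      rw [e0, abs_lt] at h0
      rw [e1, abs_lt] at h1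
      rw [abs_lt]
      constructor <;> linarith
    set w : Plane := !₂[-v 1, v 0] with hw
    have hwN : ‖w‖ = N := by
      rw [← sq_eq_sq₀ (norm_nonneg _) hN.le, hN2, EuclideanSpace.real_norm_sq_eq,
        Fin.sum_univ_two]
      simp [hw]
      ring
    have hpv : p = a p • v + (b p * r / N) • w := by
      have hv2 : v 0 ^ 2 + v 1 ^ 2 ≠ 0 := by rw [← hN2]; positivity
      have hb' : b p * r / N = (p 1 * v 0 - p 0 * v 1) / (v 0 ^ 2 + v 1 ^ 2) := by
        rw [← hN2]
        simp only [hb]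
        field_simp
      rw [hb']
      simp only [ha, hN2]
      ext i
      fin_cases i <;> simp [hw] <;> field_simp <;> ring
    have hq : ‖(b p * r / N) • w‖ < r * (1 - a p) := by
      rw [norm_smul, hwN, Real.norm_eq_abs, abs_div, abs_mul, abs_of_pos hN, abs_of_pos hr,
        div_mul_cancel₀ _ hN.ne', mul_comm]
      exact mul_lt_mul_of_pos_left habs hr
    have hint : p ∈ interior (convexHull ℝ (A ∪ {v})) := by
      rw [hpv]
      refine (convex_convexHull ℝ _).smul_add_mem_interior hr ?_ ?_ hta hq
      · exact Metric.ball_subset_closedBall.trans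
          (hD.trans (subset_union_left.trans (subset_convexHull ℝ _)))
      · exact subset_convexHull ℝ _ (Or.inr rfl)
    have hlat : IsKLatticePoint k p := by
      intro i
      refine ⟨m i, ?_⟩
      fin_cases i <;> simp [hp]
    have hp0 : p = 0 := by
      have : p ∈ ({0} : Set Plane) := hexp ▸ ⟨hint, hlat⟩
      exact this
    apply hm0
    ext i
    have := congrArg (fun x : Plane => x i) hp0
    fin_cases i <;> simpa [hp, hk0.ne'] using this
  refine key n hn0 hn ?_
  have hneg := key (-n) (neg_ne_zero.2 hn0) fun i => by
    have : (fun j => (((-n) j : ℤ) : ℝ)) = -fun j => (n j : ℝ) := by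
      ext j
      simp
    rw [this, Matrix.mulVec_neg, Pi.neg_apply, abs_neg]
    exact hn i
  simp at hneg
  linarith
end
end

section
/- Under the slope-ordered irredundant hypotheses below, one has the inequality r + 1 ≤ (m⁺ − ℓ⁺) − (m⁻ + ℓ⁻) + 4. -/
/-- Distinct fractions with positive denominators `a`, `b` differ by at least `1 / (a * b)`, hence
by at least `1 / a + 1 / b - 1`. -/
lemma inv_add_inv_le_of_div_lt_div {a b x y : ℤ} (ha : 1 ≤ a) (hb : 1 ≤ b)
    (h : (y : ℚ) / b < (x : ℚ) / a) :
    1 / (a : ℚ) + 1 / (b : ℚ) ≤ (x : ℚ) / a - (y : ℚ) / b + 1 := by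
  have ha' : (1 : ℚ) ≤ a := by exact_mod_cast ha
  have hb' : (1 : ℚ) ≤ b := by exact_mod_cast hb
  have ha0 : (0 : ℚ) < a := by linarith
  have hb0 : (0 : ℚ) < b := by linarith
  rw [div_lt_div_iff₀ hb0 ha0] at h
  have h1 : y * a + 1 ≤ x * b := by
    have : y * a < x * b := by exact_mod_cast h
    omega
  have h2 : (y : ℚ) * a + 1 ≤ x * b := by exact_mod_cast h1
  have key : (x : ℚ) / a - (y : ℚ) / b + 1 - (1 / (a : ℚ) + 1 / (b : ℚ)) =
      ((x * b - y * a - 1) + (a - 1) * (b - 1)) / (a * b) := by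
    field_simp
    ring
  have : 0 ≤ ((x * b - y * a - 1) + (a - 1) * (b - 1) : ℚ) / (a * b) := by
    apply div_nonneg _ (mul_pos ha0 hb0).le
    nlinarith [mul_nonneg (sub_nonneg.2 ha') (sub_nonneg.2 hb')]
  linarith

/-- In an irredundant slope-ordered block, the reciprocals of the first and last denominators
exceed the total slope drop by at most `1`. -/
lemma inv_add_inv_le_slope_drop {n : ℕ} {l d : ℕ → ℤ} (hn : 1 ≤ n)
    (hl : ∀ j < n, 1 ≤ l j)
    (hslope : ∀ j, j + 1 < n → (d (j + 1) : ℚ) / (l (j + 1) : ℚ) < (d j : ℚ) / (l j : ℚ))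
    (hirr : 1 < l 0 * (n : ℤ)) :
    1 / (l 0 : ℚ) + 1 / (l (n - 1) : ℚ) ≤
      (d 0 : ℚ) / (l 0 : ℚ) - (d (n - 1) : ℚ) / (l (n - 1) : ℚ) + 1 := by
  rcases hn.eq_or_lt with rfl | hn2
  · have h2 : (2 : ℚ) ≤ l 0 := by
      have : 1 + 1 ≤ l 0 := Int.add_one_le_iff.2 (by simpa using hirr)
      exact_mod_cast this
    have : 1 / (l 0 : ℚ) ≤ 1 / 2 := one_div_le_one_div_of_le (by norm_num) h2
    simp only [Nat.sub_self]
    linarith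
  · have drop : ∀ j, j + 1 < n → (d (j + 1) : ℚ) / (l (j + 1) : ℚ) < (d 0 : ℚ) / (l 0 : ℚ) := by
      intro j
      induction j with
      | zero => exact hslope 0
      | succ j ih => exact fun hj => (hslope _ hj).trans (ih (by omega))
    obtain ⟨k, rfl⟩ : ∃ k, n = k + 2 := ⟨n - 2, by omega⟩
    exact inv_add_inv_le_of_div_lt_div (hl _ (by omega)) (hl _ (by omega)) (drop k (by omega))

/-- For slope-ordered irredundant data `(l_{ij}, d_{ij})` with slopes
`m_{ij} = d_{ij}/l_{ij}`, setting `m⁺ = Σᵢ m_{i1}`, `m⁻ = Σᵢ m_{i n_i}`,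
`ℓ⁺ = Σᵢ 1/l_{i1} − r + 1` and `ℓ⁻ = Σᵢ 1/l_{i n_i} − r + 1`, one has
`r + 1 ≤ (m⁺ − ℓ⁺) − (m⁻ + ℓ⁻) + 4`.  Here `j = 0` corresponds to the first slope
`m_{i1}` and `j = n i − 1` to the last slope `m_{i n_i}`. -/
theorem stmt_9 (r : ℕ) (hr : 2 ≤ r) (n : ℕ → ℕ) (l d : ℕ → ℕ → ℤ)
    (hn : ∀ i ≤ r, 1 ≤ n i)
    (hl : ∀ i ≤ r, ∀ j < n i, 1 ≤ l i j)
    (hgcd : ∀ i ≤ r, ∀ j < n i, Int.gcd (l i j) (d i j) = 1)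
    (hslope : ∀ i ≤ r, ∀ j, j + 1 < n i →
      (d i (j + 1) : ℚ) / (l i (j + 1) : ℚ) < (d i j : ℚ) / (l i j : ℚ))
    (hirr : ∀ i ≤ r, 1 < l i 0 * (n i : ℤ)) :
    (r : ℚ) + 1 ≤
      ((∑ i ∈ Finset.range (r + 1), (d i 0 : ℚ) / (l i 0 : ℚ)) -
          ((∑ i ∈ Finset.range (r + 1), 1 / (l i 0 : ℚ)) - (r : ℚ) + 1)) -
        ((∑ i ∈ Finset.range (r + 1), (d i (n i - 1) : ℚ) / (l i (n i - 1) : ℚ)) +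
          ((∑ i ∈ Finset.range (r + 1), 1 / (l i (n i - 1) : ℚ)) - (r : ℚ) + 1)) + 4 := by
  have h := Finset.sum_le_sum fun i (hi : i ∈ Finset.range (r + 1)) =>
    have hir : i ≤ r := Nat.lt_succ_iff.1 (Finset.mem_range.1 hi)
    inv_add_inv_le_slope_drop (hn i hir) (hl i hir) (hslope i hir) (hirr i hir)
  simp only [Finset.sum_add_distrib, Finset.sum_sub_distrib, Finset.sum_const, Finset.card_range,
    nsmul_eq_mul, mul_one] at h
  push_cast at h
  linarith
end

section
/- Under the slope-ordered irredundant hypotheses below, one has m⁺ ≥ ℓ⁺ or m⁻ ≤ −ℓ⁻. -/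
/-- Subtracting `1 / l` from `d / l` keeps it at least `⌈d / l⌉ - 1`. -/
theorem ceil_sub_one_le_sub_one_div {l : ℤ} (d : ℤ) (hl : 1 ≤ l) :
    (⌈(d : ℚ) / l⌉ : ℚ) - 1 ≤ (d : ℚ) / l - 1 / l := by
  have hl0 : (0 : ℚ) < l := by exact_mod_cast hl
  have h : (⌈(d : ℚ) / l⌉ : ℚ) - 1 < (d : ℚ) / l := by linarith [Int.ceil_lt_add_one ((d : ℚ) / l)]
  rw [lt_div_iff₀ hl0] at h
  rw [← sub_div, le_div_iff₀ hl0]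
  have h' : (⌈(d : ℚ) / l⌉ - 1) * l < d := by exact_mod_cast h
  exact_mod_cast Int.le_sub_one_of_lt h'

/-- Adding `1 / l` to `d / l` keeps it at most `⌊d / l⌋ + 1`. -/
theorem add_one_div_le_floor_add_one {l : ℤ} (d : ℤ) (hl : 1 ≤ l) :
    (d : ℚ) / l + 1 / l ≤ (⌊(d : ℚ) / l⌋ : ℚ) + 1 := by
  have hl0 : (0 : ℚ) < l := by exact_mod_cast hl
  have h := Int.lt_floor_add_one ((d : ℚ) / l)
  rw [div_lt_iff₀ hl0] at h
  rw [← add_div, div_le_iff₀ hl0]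
  have h' : d < (⌊(d : ℚ) / l⌋ + 1) * l := by exact_mod_cast h
  exact_mod_cast Int.add_one_le_of_lt h'

/-- A fraction in lowest terms with denominator larger than one is not an integer. -/
theorem floor_div_lt_ceil_div_of_gcd_eq_one {l d : ℤ} (hl : 1 < l) (hgcd : Int.gcd l d = 1) :
    ⌊(d : ℚ) / l⌋ < ⌈(d : ℚ) / l⌉ := by
  have hl0 : (l : ℚ) ≠ 0 := by exact_mod_cast (by omega : l ≠ 0)
  by_contra! h
  have h1 : (d : ℚ) / l = ⌊(d : ℚ) / l⌋ :=
    le_antisymm ((Int.le_ceil _).trans (by exact_mod_cast h)) (Int.floor_le _)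
  rw [div_eq_iff hl0] at h1
  have h2 : d = ⌊(d : ℚ) / l⌋ * l := by exact_mod_cast h1
  have h3 : l ∣ (Int.gcd l d : ℤ) := Int.dvd_coe_gcd dvd_rfl (Dvd.intro_left _ h2.symm)
  rw [hgcd] at h3
  have := Int.le_of_dvd one_pos h3
  omega

/-- In a strictly decreasing finite sequence every later term is below the first one. -/
theorem apply_succ_lt_apply_zero {α : Type*} [Preorder α] {n : ℕ} {f : ℕ → α}
    (hf : ∀ j, j + 1 < n → f (j + 1) < f j) : ∀ j, j + 1 < n → f (j + 1) < f 0
  | 0, h => hf 0 h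
  | j + 1, h => (hf (j + 1) h).trans (apply_succ_lt_apply_zero hf j (by omega))

/-- Irredundant slope-ordered data have an integer gap between first and last slope. -/
theorem floor_last_lt_ceil_first {n : ℕ} {l d : ℕ → ℤ} (hn : 1 ≤ n)
    (hgcd : ∀ j < n, Int.gcd (l j) (d j) = 1)
    (hslope : ∀ j, j + 1 < n → (d (j + 1) : ℚ) / (l (j + 1) : ℚ) < (d j : ℚ) / (l j : ℚ))
    (hirr : 1 < l 0 * (n : ℤ)) :
    ⌊(d (n - 1) : ℚ) / l (n - 1)⌋ < ⌈(d 0 : ℚ) / l 0⌉ := by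
  obtain _ | _ | k := n
  · omega
  · exact floor_div_lt_ceil_div_of_gcd_eq_one (by simpa using hirr) (hgcd 0 one_pos)
  · have h := apply_succ_lt_apply_zero (f := fun j => (d j : ℚ) / l j) hslope k (by omega)
    have h' := ((Int.floor_le _).trans_lt h).trans_le (Int.le_ceil _)
    exact_mod_cast h'


/-- For slope-ordered irredundant data `(l_{ij}, d_{ij})` with slopes
`m_{ij} = d_{ij}/l_{ij}`, setting `m⁺ = Σᵢ m_{i1}`, `m⁻ = Σᵢ m_{i n_i}`,
`ℓ⁺ = Σᵢ 1/l_{i1} − r + 1` and `ℓ⁻ = Σᵢ 1/l_{i n_i} − r + 1`, one has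
`m⁺ ≥ ℓ⁺` or `m⁻ ≤ −ℓ⁻`.  Here `j = 0` corresponds to the first slope `m_{i1}` and
`j = n i − 1` to the last slope `m_{i n_i}`. -/
theorem stmt_10 (r : ℕ) (hr : 2 ≤ r) (n : ℕ → ℕ) (l d : ℕ → ℕ → ℤ)
    (hn : ∀ i ≤ r, 1 ≤ n i)
    (hl : ∀ i ≤ r, ∀ j < n i, 1 ≤ l i j)
    (hgcd : ∀ i ≤ r, ∀ j < n i, Int.gcd (l i j) (d i j) = 1)
    (hslope : ∀ i ≤ r, ∀ j, j + 1 < n i →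
      (d i (j + 1) : ℚ) / (l i (j + 1) : ℚ) < (d i j : ℚ) / (l i j : ℚ))
    (hirr : ∀ i ≤ r, 1 < l i 0 * (n i : ℤ)) :
    ((∑ i ∈ Finset.range (r + 1), 1 / (l i 0 : ℚ)) - (r : ℚ) + 1 ≤
        ∑ i ∈ Finset.range (r + 1), (d i 0 : ℚ) / (l i 0 : ℚ)) ∨
      (∑ i ∈ Finset.range (r + 1), (d i (n i - 1) : ℚ) / (l i (n i - 1) : ℚ) ≤
        -((∑ i ∈ Finset.range (r + 1), 1 / (l i (n i - 1) : ℚ)) - (r : ℚ) + 1)) := by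
  by_contra! h
  obtain ⟨h1, h2⟩ := h
  have hc : ∑ i ∈ Finset.range (r + 1), ((⌈(d i 0 : ℚ) / l i 0⌉ : ℚ) - 1) ≤
      ∑ i ∈ Finset.range (r + 1), ((d i 0 : ℚ) / l i 0 - 1 / l i 0) :=
    Finset.sum_le_sum fun i hi => by
      have hi : i ≤ r := Finset.mem_range_succ_iff.mp hi
      exact ceil_sub_one_le_sub_one_div _ (hl i hi 0 (hn i hi))
  have hf : ∑ i ∈ Finset.range (r + 1),
        ((d i (n i - 1) : ℚ) / l i (n i - 1) + 1 / l i (n i - 1)) ≤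
      ∑ i ∈ Finset.range (r + 1), ((⌊(d i (n i - 1) : ℚ) / l i (n i - 1)⌋ : ℚ) + 1) :=
    Finset.sum_le_sum fun i hi => by
      have hi : i ≤ r := Finset.mem_range_succ_iff.mp hi
      exact add_one_div_le_floor_add_one _ (hl i hi _ (Nat.sub_one_lt_of_lt (hn i hi)))
  have hgap : ∑ i ∈ Finset.range (r + 1), (⌊(d i (n i - 1) : ℚ) / l i (n i - 1)⌋ + 1) ≤
      ∑ i ∈ Finset.range (r + 1), ⌈(d i 0 : ℚ) / l i 0⌉ :=
    Finset.sum_le_sum fun i hi => by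
      have hi : i ≤ r := Finset.mem_range_succ_iff.mp hi
      exact floor_last_lt_ceil_first (hn i hi) (hgcd i hi) (hslope i hi) (hirr i hi)
  simp only [Finset.sum_sub_distrib, Finset.sum_add_distrib, Finset.sum_const, Finset.card_range,
    nsmul_eq_mul, mul_one, Nat.cast_add, Nat.cast_one] at hc hf hgap
  have hC : ∑ i ∈ Finset.range (r + 1), ⌈(d i 0 : ℚ) / l i 0⌉ < 2 := by
    have : ∑ i ∈ Finset.range (r + 1), (⌈(d i 0 : ℚ) / l i 0⌉ : ℚ) < 2 := by linarith
    exact_mod_cast this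
  have hF : -2 < ∑ i ∈ Finset.range (r + 1), ⌊(d i (n i - 1) : ℚ) / l i (n i - 1)⌋ := by
    have : -2 < ∑ i ∈ Finset.range (r + 1), (⌊(d i (n i - 1) : ℚ) / l i (n i - 1)⌋ : ℚ) := by
      linarith
    exact_mod_cast this
  omega
end

section
/- Let r ≥ 1 be an integer, let l₀, …, l_r be positive integers and d₀, …, d_r integers, and assume m⁺ := Σ_{i=0}^r d_i/l_i ≠ 0. In ℚ^{r+1} set v₀ := (−l₀, …, −l₀, d₀) (entry −l₀ in the first r coordinates, d₀ in the last) and, for i = 1, …, r, v_i := l_i·e_i + d_i·e_{r+1}, where e₁, …, e_{r+1} is the standard basis. Set l⁺ := l₀⋯l_r, ℓ⁺ := Σ_{i=0}^r 1/l_i − r + 1, and for i = 1, …, r define u_i := (r−1)·d_i·(l⁺/l_i) + Σ_{j≠i, 0≤j≤r} (d_j − d_i)·l⁺/(l_j·l_i). Then u := (1/(l⁺·m⁺))·(u₁, …, u_r, l⁺·ℓ⁺) ∈ ℚ^{r+1} is the unique vector satisfying ⟨u, v₀⟩ = 1 − (r−1)·l₀ and ⟨u, v_i⟩ = 1 for all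 i = 1, …, r. -/
noncomputable section

/-- `l⁺ = l₀ ⋯ l_r`. -/
def lPlus (r : ℕ) (l : ℕ → ℤ) : ℚ := ∏ i ∈ Finset.range (r + 1), (l i : ℚ)

/-- `m⁺ = Σᵢ dᵢ/lᵢ`. -/
def mPlus (r : ℕ) (l d : ℕ → ℤ) : ℚ := ∑ i ∈ Finset.range (r + 1), (d i : ℚ) / (l i : ℚ)

/-- `ℓ⁺ = Σᵢ 1/lᵢ − r + 1`. -/
def ellPlus (r : ℕ) (l : ℕ → ℤ) : ℚ :=
  (∑ i ∈ Finset.range (r + 1), 1 / (l i : ℚ)) - (r : ℚ) + 1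

/-- `uᵢ = (r−1)·dᵢ·(l⁺/lᵢ) + Σ_{j ≠ i} (d_j − dᵢ)·l⁺/(l_j·lᵢ)`. -/
def uEntry (r : ℕ) (l d : ℕ → ℤ) (i : ℕ) : ℚ :=
  ((r : ℚ) - 1) * (d i : ℚ) * (lPlus r l / (l i : ℚ)) +
    ∑ j ∈ (Finset.range (r + 1)).erase i,
      ((d j : ℚ) - (d i : ℚ)) * lPlus r l / ((l j : ℚ) * (l i : ℚ))

/-- `u = (1/(l⁺·m⁺)) · (u₁, …, u_r, l⁺·ℓ⁺)` (coordinates indexed by `0, …, r`, so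
coordinate `t < r` is `u_{t+1}` and the last coordinate is `l⁺·ℓ⁺`, all divided by
`l⁺·m⁺`). -/
def uVec (r : ℕ) (l d : ℕ → ℤ) : Fin (r + 1) → ℚ := fun t =>
  (1 / (lPlus r l * mPlus r l d)) *
    (if (t : ℕ) = r then lPlus r l * ellPlus r l else uEntry r l d ((t : ℕ) + 1))

/-- `v₀ = (−l₀, …, −l₀, d₀)`. -/
def vZero (r : ℕ) (l d : ℕ → ℤ) : Fin (r + 1) → ℚ := fun t =>
  if (t : ℕ) = r then (d 0 : ℚ) else -(l 0 : ℚ)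

/-- `vᵢ = lᵢ·eᵢ + dᵢ·e_{r+1}` (with `e₁, …, e_{r+1}` the standard basis, so in
`0`-indexed coordinates `vᵢ` has entry `lᵢ` at position `i − 1` and `dᵢ` at
position `r`). -/
def vArm (r : ℕ) (l d : ℕ → ℤ) (i : ℕ) : Fin (r + 1) → ℚ := fun t =>
  if (t : ℕ) = r then (d i : ℚ) else if (t : ℕ) + 1 = i then (l i : ℚ) else 0

lemma sum_mul_vArm_succ (r : ℕ) (l d : ℕ → ℤ) (w : Fin (r + 1) → ℚ) (k : Fin r) :
    ∑ t, w t * vArm r l d (k + 1) t =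
      w k.castSucc * (l (k + 1) : ℚ) + w (Fin.last r) * (d (k + 1) : ℚ) := by
  rw [Fin.sum_univ_castSucc, Finset.sum_eq_single k]
  · simp [vArm, k.isLt.ne]
  · intro j _ hj
    simp [vArm, j.isLt.ne, Fin.val_ne_of_ne hj]
  · simp

lemma sum_mul_vZero (r : ℕ) (l d : ℕ → ℤ) (w : Fin (r + 1) → ℚ) :
    ∑ t, w t * vZero r l d t =
      -(l 0 : ℚ) * ∑ k : Fin r, w k.castSucc + w (Fin.last r) * (d 0 : ℚ) := by
  rw [Fin.sum_univ_castSucc, Finset.mul_sum]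
  congr 1
  · refine Finset.sum_congr rfl fun k _ => ?_
    simp [vZero, k.isLt.ne, mul_comm]
  · simp [vZero]

/-- A vector pairing to `1` with all `vᵢ`, `i ≥ 1`, has a pairing with `v₀` that depends only on
its last coordinate. -/
lemma sum_mul_vZero_of_forall_vArm {r : ℕ} {l d : ℕ → ℤ} (hl : ∀ i ≤ r, 0 < l i)
    {w : Fin (r + 1) → ℚ}
    (hw : ∀ k : Fin r, w k.castSucc * (l (k + 1) : ℚ) + w (Fin.last r) * (d (k + 1) : ℚ) = 1) :
    ∑ t, w t * vZero r l d t =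
      1 - ((r : ℚ) - 1) * (l 0 : ℚ) +
        (l 0 : ℚ) * (w (Fin.last r) * mPlus r l d - ellPlus r l) := by
  have h0 : (l 0 : ℚ) ≠ 0 := by exact_mod_cast (hl 0 (Nat.zero_le r)).ne'
  have hsum : ∑ k : Fin r, w k.castSucc =
      ∑ k : Fin r, 1 / (l (k + 1) : ℚ) -
        w (Fin.last r) * ∑ k : Fin r, (d (k + 1) : ℚ) / (l (k + 1) : ℚ) := by
    rw [Finset.mul_sum, ← Finset.sum_sub_distrib]
    refine Finset.sum_congr rfl fun k _ => ?_
    have hk : (l (k + 1) : ℚ) ≠ 0 := by exact_mod_cast (hl (k + 1) k.isLt).ne'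
    field_simp
    linear_combination hw k
  rw [sum_mul_vZero, hsum, mPlus, ellPlus, Finset.sum_range_succ', Finset.sum_range_succ',
    Finset.sum_range, Finset.sum_range]
  field_simp
  ring

lemma lPlus_ne_zero {r : ℕ} {l : ℕ → ℤ} (hl : ∀ i ≤ r, 0 < l i) : lPlus r l ≠ 0 :=
  Finset.prod_ne_zero_iff.mpr fun i hi => by
    exact_mod_cast (hl i (Nat.lt_succ_iff.mp (Finset.mem_range.mp hi))).ne'

lemma uEntry_eq (r : ℕ) (l d : ℕ → ℤ) (i : ℕ) :
    uEntry r l d i =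
      lPlus r l / (l i : ℚ) * (mPlus r l d - (d i : ℚ) * ellPlus r l) := by
  have hsum : ∑ j ∈ (Finset.range (r + 1)).erase i,
      ((d j : ℚ) - (d i : ℚ)) * lPlus r l / ((l j : ℚ) * (l i : ℚ)) =
      lPlus r l / (l i : ℚ) * (mPlus r l d -
        (d i : ℚ) * ∑ j ∈ Finset.range (r + 1), 1 / (l j : ℚ)) := by
    rw [Finset.sum_erase _ (by simp), mPlus, Finset.mul_sum, ← Finset.sum_sub_distrib,
      Finset.mul_sum]
    refine Finset.sum_congr rfl fun j _ => ?_
    simp only [div_eq_mul_inv, mul_inv]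
    ring
  rw [uEntry, hsum, ellPlus]
  ring

lemma uVec_last {r : ℕ} {l : ℕ → ℤ} (d : ℕ → ℤ) (hl : ∀ i ≤ r, 0 < l i) :
    uVec r l d (Fin.last r) = ellPlus r l / mPlus r l d := by
  have hL := lPlus_ne_zero hl
  simp only [uVec, Fin.val_last, if_true]
  rw [one_div_mul_eq_div, mul_div_mul_left _ _ hL]

lemma uVec_castSucc_mul_add {r : ℕ} {l d : ℕ → ℤ} (hl : ∀ i ≤ r, 0 < l i)
    (hm : mPlus r l d ≠ 0) (k : Fin r) :
    uVec r l d k.castSucc * (l (k + 1) : ℚ) +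
      uVec r l d (Fin.last r) * (d (k + 1) : ℚ) = 1 := by
  have hL := lPlus_ne_zero hl
  have hk : (l (k + 1) : ℚ) ≠ 0 := by exact_mod_cast (hl (k + 1) k.isLt).ne'
  rw [uVec_last d hl]
  simp only [uVec, Fin.val_castSucc, k.isLt.ne, if_false]
  rw [uEntry_eq]
  field_simp
  ring

/-- If all `lᵢ` are positive and `m⁺ ≠ 0`, then
`u = (1/(l⁺·m⁺))·(u₁, …, u_r, l⁺·ℓ⁺)` is the unique vector of `ℚ^{r+1}` satisfying
`⟨u, v₀⟩ = 1 − (r−1)·l₀` and `⟨u, vᵢ⟩ = 1` for `i = 1, …, r`. -/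
theorem stmt_12 (r : ℕ) (hr : 1 ≤ r) (l d : ℕ → ℤ)
    (hl : ∀ i ≤ r, 0 < l i) (hm : mPlus r l d ≠ 0) :
    (∑ t, uVec r l d t * vZero r l d t = 1 - ((r : ℚ) - 1) * (l 0 : ℚ)) ∧
    (∀ i, 1 ≤ i → i ≤ r → ∑ t, uVec r l d t * vArm r l d i t = 1) ∧
    (∀ w : Fin (r + 1) → ℚ,
      (∑ t, w t * vZero r l d t = 1 - ((r : ℚ) - 1) * (l 0 : ℚ)) →
      (∀ i, 1 ≤ i → i ≤ r → ∑ t, w t * vArm r l d i t = 1) →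
      w = uVec r l d) := by
  have hu := uVec_castSucc_mul_add hl hm
  refine ⟨?_, ?_, ?_⟩
  · rw [sum_mul_vZero_of_forall_vArm hl hu, uVec_last d hl, div_mul_cancel₀ _ hm]
    ring
  · intro i hi hir
    obtain ⟨k, rfl⟩ := Nat.exists_eq_add_of_le' hi
    rw [sum_mul_vArm_succ r l d _ ⟨k, hir⟩]
    exact hu ⟨k, hir⟩
  · intro w hw₀ hw
    have hw' : ∀ k : Fin r,
        w k.castSucc * (l (k + 1) : ℚ) + w (Fin.last r) * (d (k + 1) : ℚ) = 1 := fun k => by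
      rw [← sum_mul_vArm_succ]
      exact hw (k + 1) (Nat.le_add_left 1 k) k.isLt
    have h0 : (l 0 : ℚ) ≠ 0 := by exact_mod_cast (hl 0 (Nat.zero_le r)).ne'
    rw [sum_mul_vZero_of_forall_vArm hl hw', add_eq_left, mul_eq_zero,
      or_iff_right h0, sub_eq_zero] at hw₀
    have hlast : w (Fin.last r) = uVec r l d (Fin.last r) := by
      rw [uVec_last d hl, eq_div_iff hm, hw₀]
    funext t
    refine Fin.lastCases hlast (fun k => ?_) t
    have hk : (l (k + 1) : ℚ) ≠ 0 := by exact_mod_cast (hl (k + 1) k.isLt).ne'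
    refine mul_right_cancel₀ hk ?_
    linear_combination hw' k - hu k - (d (k + 1) : ℚ) * hlast
end
end

section
/- Let v₁, v₂ ∈ ℤ² be primitive and linearly independent, and let ι ≥ 1 be an integer. (i) For ι = 1: there exists a primitive u ∈ ℤ² with ⟨u, v₁⟩ = ⟨u, v₂⟩ = 1 if and only if there exist M ∈ GL₂(ℤ) and an integer a ≥ 1 such that M·v₁ = (1,0) and M·v₂ = (1,a). (ii) For ι ≥ 2: there exists a primitive u ∈ ℤ² with ⟨u, v₁⟩ = ⟨u, v₂⟩ = ι if and only if there exist M ∈ GL₂(ℤ) and integers b ≥ 2 and κ with 1 ≤ κ ≤ ι−1, κ ∣ b−1, gcd(κ, ι) = 1 and gcd(b, ι(b−1)/κ) = 1, such that M·v₁ = (1,0) and M·v₂ = (b, ι(b−1)/κ). -/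
/-- An integral linear map of determinant `±1` sends coprime pairs to coprime pairs. -/
lemma IsCoprime.of_unimodular {a b c d x y : ℤ} (hdet : IsUnit (a * d - b * c))
    (h : IsCoprime x y) : IsCoprime (a * x + b * y) (c * x + d * y) := by
  obtain ⟨p, q, hpq⟩ := h
  have he := Int.isUnit_mul_self hdet
  refine ⟨(a * d - b * c) * (p * d - q * c), (a * d - b * c) * (q * a - p * b), ?_⟩
  linear_combination (p * x + q * y) * he + hpq

lemma exists_eq_mul_sub_mul {p q x y ι : ℤ} (h1 : IsCoprime p q) (hι : 1 ≤ ι)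
    (hu : x * p + y * q = ι) {ε : ℤ} (hε : ε * ε = 1) :
    ∃ r s κ : ℤ, r * p + s * q = 1 ∧ 0 ≤ κ ∧ κ < ι ∧
      x = ι * r + κ * ε * q ∧ y = ι * s - κ * ε * p := by
  obtain ⟨s, t, hst⟩ := h1
  set c := s * y - t * x with hc
  have hk := Int.emod_add_mul_ediv (-(ε * c)) ι
  set κ := (-(ε * c)) % ι with hκ
  set k := (-(ε * c)) / ι
  have hc' : c = -(ε * κ) - ε * ι * k := by
    linear_combination ε * hk - c * hε
  refine ⟨s + ε * k * q, t - ε * k * p, κ, by linear_combination hst,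
    Int.emod_nonneg _ (by omega), Int.emod_lt_of_pos _ (by omega), ?_, ?_⟩
  · linear_combination s * hu - x * hst + q * hc - q * hc'
  · linear_combination t * hu - y * hst - p * hc + p * hc'

lemma det_ne_zero_of_linearIndependent_pair {v₁ v₂ : Fin 2 → ℤ} (h1 : IsCoprime (v₁ 0) (v₁ 1))
    (hind : LinearIndependent ℤ ![v₁, v₂]) : v₁ 0 * v₂ 1 - v₁ 1 * v₂ 0 ≠ 0 := by
  intro h
  rw [LinearIndependent.pair_iff] at hind
  have e0 := (hind (v₂ 0) (-v₁ 0) (by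
    ext i; fin_cases i <;> simp <;> linarith)).2
  have e1 := (hind (v₂ 1) (-v₁ 1) (by
    ext i; fin_cases i <;> simp <;> linarith)).2
  obtain ⟨a, b, hab⟩ := h1
  rw [neg_eq_zero] at e0 e1
  simp [e0, e1] at hab

/-- Two primitive, linearly independent vectors lie on a line of integral distance `ι` from the
origin iff they can be moved simultaneously to `(1, 0)` and `(1 + κ * m, ι * m)` with `m ≥ 1`
and a residue `κ` coprime to `ι`. -/
lemma exists_primitive_form_iff {v₁ v₂ : Fin 2 → ℤ} (h1 : IsCoprime (v₁ 0) (v₁ 1))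
    (hind : LinearIndependent ℤ ![v₁, v₂]) {ι : ℤ} (hι : 1 ≤ ι) :
    (∃ u : Fin 2 → ℤ, Int.gcd (u 0) (u 1) = 1 ∧
        u 0 * v₁ 0 + u 1 * v₁ 1 = ι ∧ u 0 * v₂ 0 + u 1 * v₂ 1 = ι) ↔
      ∃ M : Matrix (Fin 2) (Fin 2) ℤ, IsUnit M.det ∧ ∃ m κ : ℤ,
        1 ≤ m ∧ 0 ≤ κ ∧ κ < ι ∧ IsCoprime κ ι ∧
        M.mulVec v₁ = ![1, 0] ∧ M.mulVec v₂ = ![1 + κ * m, ι * m] := by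
  constructor
  · rintro ⟨u, hu, hu1, hu2⟩
    have hne := det_ne_zero_of_linearIndependent_pair h1 hind
    set D := v₁ 0 * v₂ 1 - v₁ 1 * v₂ 0 with hD
    obtain ⟨ε, hε, hpos⟩ : ∃ ε : ℤ, ε * ε = 1 ∧ 0 < ε * D := by
      rcases lt_or_gt_of_ne hne with h | h
      · exact ⟨-1, by norm_num, by linarith⟩
      · exact ⟨1, by norm_num, by linarith⟩
    obtain ⟨r, s, κ, hrs, hκ0, hκι, hx, hy⟩ := exists_eq_mul_sub_mul h1 hι hu1 hε
    have hcop : IsCoprime κ ι := by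
      obtain ⟨a, b, hab⟩ := Int.isCoprime_iff_gcd_eq_one.2 hu
      exact ⟨a * ε * v₁ 1 - b * ε * v₁ 0, a * r + b * s, by
        linear_combination hab - a * hx - b * hy⟩
    have hrel : ι = ι * (r * v₂ 0 + s * v₂ 1) - κ * (ε * D) := by
      linear_combination -hu2 + v₂ 0 * hx + v₂ 1 * hy + κ * ε * hD
    obtain ⟨m, hm⟩ : ι ∣ ε * D := hcop.symm.dvd_of_dvd_mul_left
      ⟨r * v₂ 0 + s * v₂ 1 - 1, by linear_combination hrel⟩
    have hm1 : 1 ≤ m := by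
      rw [hm] at hpos
      exact pos_of_mul_pos_right hpos (by omega)
    have hb : r * v₂ 0 + s * v₂ 1 = 1 + κ * m := by
      apply mul_left_cancel₀ (show ι ≠ 0 by omega)
      linear_combination -hrel + κ * hm
    refine ⟨!![r, s; -(ε * v₁ 1), ε * v₁ 0], ?_, m, κ, hm1, hκ0, hκι, hcop, ?_, ?_⟩
    · rw [Matrix.det_fin_two_of]
      have : r * (ε * v₁ 0) - s * -(ε * v₁ 1) = ε := by linear_combination ε * hrs
      rw [this]
      exact IsUnit.of_mul_eq_one _ hε
    · ext i
      fin_cases i <;> simp [Matrix.mulVec, dotProduct, Fin.sum_univ_two]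
      · exact hrs
      · ring
    · ext i
      fin_cases i <;> simp [Matrix.mulVec, dotProduct, Fin.sum_univ_two]
      · exact hb
      · linear_combination hm + ε * hD
  · rintro ⟨M, hM, m, κ, -, -, -, hcop, hM1, hM2⟩
    have e10 := congrFun hM1 0
    have e11 := congrFun hM1 1
    have e20 := congrFun hM2 0
    have e21 := congrFun hM2 1
    simp [Matrix.mulVec, dotProduct, Fin.sum_univ_two] at e10 e11 e20 e21
    rw [Matrix.det_fin_two, mul_comm (M 0 1)] at hM
    refine ⟨![M 0 0 * ι + M 1 0 * -κ, M 0 1 * ι + M 1 1 * -κ],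
      Int.isCoprime_iff_gcd_eq_one.1 (hcop.symm.neg_right.of_unimodular hM), ?_, ?_⟩
    · simp
      linear_combination ι * e10 - κ * e11
    · simp
      linear_combination ι * e20 - κ * e21


/-- Let `v₁, v₂ ∈ ℤ²` be primitive and linearly independent and let
`ι ≥ 1`.
(i) For `ι = 1`: a primitive `u` with `⟨u,v₁⟩ = ⟨u,v₂⟩ = 1` exists iff some
`M ∈ GL₂(ℤ)` maps `v₁` to `(1,0)` and `v₂` to `(1,a)` with an integer `a ≥ 1`.
(ii) For `ι ≥ 2`: a primitive `u` with `⟨u,v₁⟩ = ⟨u,v₂⟩ = ι` exists iff some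
`M ∈ GL₂(ℤ)` maps `v₁` to `(1,0)` and `v₂` to `(b, ι(b−1)/κ)` for integers `b ≥ 2`
and `1 ≤ κ ≤ ι−1` with `κ ∣ b−1`, `gcd(κ, ι) = 1` and `gcd(b, ι(b−1)/κ) = 1`. -/
theorem stmt_13 (v₁ v₂ : Fin 2 → ℤ)
    (h1 : Int.gcd (v₁ 0) (v₁ 1) = 1) (h2 : Int.gcd (v₂ 0) (v₂ 1) = 1)
    (hind : LinearIndependent ℤ ![v₁, v₂]) (ι : ℤ) (hι : 1 ≤ ι) :
    (ι = 1 →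
      ((∃ u : Fin 2 → ℤ, Int.gcd (u 0) (u 1) = 1 ∧
          u 0 * v₁ 0 + u 1 * v₁ 1 = 1 ∧ u 0 * v₂ 0 + u 1 * v₂ 1 = 1) ↔
        (∃ M : Matrix (Fin 2) (Fin 2) ℤ, IsUnit M.det ∧ ∃ a : ℤ, 1 ≤ a ∧
          M.mulVec v₁ = ![1, 0] ∧ M.mulVec v₂ = ![1, a]))) ∧
    (2 ≤ ι →
      ((∃ u : Fin 2 → ℤ, Int.gcd (u 0) (u 1) = 1 ∧
          u 0 * v₁ 0 + u 1 * v₁ 1 = ι ∧ u 0 * v₂ 0 + u 1 * v₂ 1 = ι) ↔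
        (∃ M : Matrix (Fin 2) (Fin 2) ℤ, IsUnit M.det ∧ ∃ b κ : ℤ,
          2 ≤ b ∧ 1 ≤ κ ∧ κ ≤ ι - 1 ∧ κ ∣ b - 1 ∧
          Int.gcd κ ι = 1 ∧ Int.gcd b (ι * ((b - 1) / κ)) = 1 ∧
          M.mulVec v₁ = ![1, 0] ∧ M.mulVec v₂ = ![b, ι * ((b - 1) / κ)]))) := by
  rw [← Int.isCoprime_iff_gcd_eq_one] at h1 h2
  refine ⟨?_, fun hι2 => ?_⟩
  · rintro rfl
    rw [exists_primitive_form_iff h1 hind le_rfl]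
    refine exists_congr fun M => and_congr_right fun _ => ⟨?_, ?_⟩
    · rintro ⟨m, κ, hm, hκ0, hκ1, -, hM1, hM2⟩
      obtain rfl : κ = 0 := by omega
      exact ⟨m, hm, hM1, by simpa using hM2⟩
    · rintro ⟨a, ha, hM1, hM2⟩
      exact ⟨a, 0, ha, le_rfl, one_pos, isCoprime_one_right, hM1, by simpa using hM2⟩
  · rw [exists_primitive_form_iff h1 hind hι]
    refine exists_congr fun M => and_congr_right fun hM => ⟨?_, ?_⟩
    · rintro ⟨m, κ, hm, hκ0, hκι, hcop, hM1, hM2⟩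
      have hκ : 1 ≤ κ := by
        by_contra hlt
        obtain rfl : κ = 0 := by omega
        rw [isCoprime_zero_left, Int.isUnit_iff] at hcop
        omega
      have hdiv : (1 + κ * m - 1) / κ = m := by
        rw [add_sub_cancel_left, Int.mul_ediv_cancel_left _ (by omega)]
      refine ⟨1 + κ * m, κ, by nlinarith, hκ, by omega, by simp,
        Int.isCoprime_iff_gcd_eq_one.1 hcop, ?_, hM1, by rwa [hdiv]⟩
      rw [hdiv, ← Int.isCoprime_iff_gcd_eq_one]
      have e0 := congrFun hM2 0
      have e1 := congrFun hM2 1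
      simp [Matrix.mulVec, dotProduct, Fin.sum_univ_two] at e0 e1
      rw [← e0, ← e1]
      rw [Matrix.det_fin_two] at hM
      exact h2.of_unimodular hM
    · rintro ⟨b, κ, hb, hκ1, hκι, ⟨m, hm⟩, hcop, -, hM1, hM2⟩
      have hdiv : (b - 1) / κ = m := by
        rw [hm, Int.mul_ediv_cancel_left _ (by omega)]
      obtain rfl : b = 1 + κ * m := by omega
      have hm1 : 1 ≤ m := pos_of_mul_pos_right (a := κ) (by omega) (by omega)
      exact ⟨m, κ, hm1, by omega, by omega, Int.isCoprime_iff_gcd_eq_one.2 hcop, hM1,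
        by rwa [hdiv] at hM2⟩
end

section
/- Let k ≥ 1 be an integer, let 𝒜 ⊆ ℝ² be a polygon with the origin in its interior, let w ∈ kℤ² with w ≠ (0,0), and let v ∈ ℝ². If v lies in the shadow S(w, 𝒜) := w + interior(cone(w − u : u ∈ 𝒜)), then w lies in the interior of the expansion 𝒜⁺_v := conv(𝒜 ∪ {v}); in particular, 𝒜⁺_v is not almost k-hollow. Consequently, all lattice vectors v for which 𝒜⁺_v is almost k-hollow lie outside every shadow S(w, 𝒜) with 0 ≠ w ∈ kℤ². -/
noncomputable section

open Set

/-- The convex cone generated by a set: all finite nonnegative linear combinations of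
its elements. -/
def coneHull (S : Set Plane) : Set Plane :=
  {y | ∃ (n : ℕ) (c : Fin n → ℝ) (x : Fin n → Plane),
    (∀ i, 0 ≤ c i) ∧ (∀ i, x i ∈ S) ∧ y = ∑ i, c i • x i}

/-- The shadow of `w` with respect to `A`:
`S(w, A) = w + interior (cone (w − u : u ∈ A))`. -/
def shadow (w : Plane) (A : Set Plane) : Set Plane :=
  (fun y => w + y) '' interior (coneHull ((fun u => w - u) '' A))

/-- If `C` is convex with `v` and all `x i` in `C` and the `c i` are nonnegative, then the weighted
mean of `v` (with weight `1`) and the `x i` (with weights `c i`) lies in `C`. -/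
theorem Convex.inv_smul_add_sum_mem {E : Type*} [AddCommGroup E] [Module ℝ E] {C : Set E}
    (hC : Convex ℝ C) {v : E} (hv : v ∈ C) {n : ℕ} {c : Fin n → ℝ} {x : Fin n → E}
    (hc : ∀ i, 0 ≤ c i) (hx : ∀ i, x i ∈ C) :
    (1 + ∑ i, c i)⁻¹ • (v + ∑ i, c i • x i) ∈ C := by
  have hT : 0 ≤ ∑ i, c i := Finset.sum_nonneg fun i _ => hc i
  have hmem := hC.centerMass_mem (t := Finset.univ)
    (w := (Fin.cons 1 c : Fin (n + 1) → ℝ)) (z := (Fin.cons v x : Fin (n + 1) → E))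
    (fun i _ => by refine Fin.cases ?_ (fun j => ?_) i <;> simp [hc])
    (by simp only [Fin.sum_univ_succ, Fin.cons_zero, Fin.cons_succ]; linarith)
    (fun i _ => by refine Fin.cases ?_ (fun j => ?_) i <;> simp [hv, hx])
  simpa [Finset.centerMass, Fin.sum_univ_succ] using hmem

/-- If a point of the shadow of `w` is added to a set with the origin in its interior, then `w`
lies in the interior of the resulting convex hull. -/
theorem mem_interior_convexHull_of_mem_shadow {A : Set Plane} (h0 : (0 : Plane) ∈ interior A)
    {w v : Plane} (hv : v ∈ shadow w A) : w ∈ interior (convexHull ℝ (A ∪ {v})) := by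
  obtain ⟨y, hy, rfl⟩ := hv
  set C := convexHull ℝ (A ∪ {w + y})
  have hAC : A ⊆ C := subset_union_left.trans (subset_convexHull ℝ _)
  have hvC : w + y ∈ C := subset_convexHull ℝ _ (Or.inr rfl)
  have hcont : Filter.Tendsto (fun ε : ℝ => y - ε • w) (nhdsWithin 0 (Ioi 0)) (nhds y) := by
    have : Continuous fun ε : ℝ => y - ε • w := by fun_prop
    simpa using (this.tendsto 0).mono_left nhdsWithin_le_nhds
  obtain ⟨ε, hεmem, (hε : 0 < ε)⟩ :=
    ((hcont.eventually (mem_interior_iff_mem_nhds.1 hy)).and self_mem_nhdsWithin).exists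
  obtain ⟨n, c, x, hc, hx, hsum⟩ := hεmem
  choose u hu hux using hx
  set T := ∑ i, c i with hTdef
  have hT : 0 ≤ T := Finset.sum_nonneg fun i _ => hc i
  have hz := (convex_convexHull ℝ (A ∪ {w + y})).inv_smul_add_sum_mem hvC hc
    fun i => hAC (hu i)
  have hsum' : y - ε • w = T • w - ∑ i, c i • u i := by
    rw [hsum, hTdef, Finset.sum_smul, ← Finset.sum_sub_distrib]
    exact Finset.sum_congr rfl fun i _ => by rw [← hux i, smul_sub]
  have hw : w + y + ∑ i, c i • u i = (1 + ε + T) • w := by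
    rw [sub_eq_iff_eq_add] at hsum'
    rw [hsum']
    module
  have key := (convex_convexHull ℝ (A ∪ {w + y})).combo_interior_self_mem_interior
    (interior_mono hAC h0) hz (a := ε / (1 + ε + T)) (b := (1 + T) / (1 + ε + T))
    (by positivity) (by positivity) (by field_simp; ring)
  rw [hw, ← hTdef, smul_zero, zero_add, smul_smul, smul_smul] at key
  rwa [show (1 + T) / (1 + ε + T) * (1 + T)⁻¹ * (1 + ε + T) = 1 by field_simp, one_smul] at key

/-- If `A` is a polygon with the origin in its interior,
`0 ≠ w ∈ k·ℤ²` and `v` lies in the shadow `S(w, A)`, then `w` lies in the interior of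
the expansion `conv(A ∪ {v})`; in particular `conv(A ∪ {v})` is not almost `k`-hollow.
Consequently, every lattice vector `v` whose expansion is almost `k`-hollow lies
outside every shadow `S(w, A)` with `0 ≠ w ∈ k·ℤ²`. -/
theorem stmt_14 (k : ℕ) (hk : 1 ≤ k) (A : Set Plane) (S : Finset Plane)
    (hA : A = convexHull ℝ (S : Set Plane))
    (h0 : (0 : Plane) ∈ interior A) :
    (∀ w : Plane, IsKLatticePoint k w → w ≠ 0 → ∀ v ∈ shadow w A,
      w ∈ interior (convexHull ℝ (A ∪ {v})) ∧
        ¬ AlmostKHollow k (convexHull ℝ (A ∪ {v}))) ∧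
    (∀ v : Plane, IsLatticePoint v → AlmostKHollow k (convexHull ℝ (A ∪ {v})) →
      ∀ w : Plane, IsKLatticePoint k w → w ≠ 0 → v ∉ shadow w A) := by
  have hnot : ∀ w : Plane, IsKLatticePoint k w → w ≠ 0 → ∀ v ∈ shadow w A,
      ¬ AlmostKHollow k (convexHull ℝ (A ∪ {v})) := fun w hw hw0 v hv hhollow =>
    hw0 (hhollow.subset ⟨mem_interior_convexHull_of_mem_shadow h0 hv, hw⟩)
  exact ⟨fun w hw hw0 v hv => ⟨mem_interior_convexHull_of_mem_shadow h0 hv, hnot w hw hw0 v hv⟩,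
    fun v _ hhollow w hw hw0 hv => hnot w hw hw0 v hv hhollow⟩
end
end
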